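/- arXiv:2407.17806 — 3 statements merged into one kernel-verified Lean document; each statement's English description precedes it below -/
import Mathlib

section
/- For every t > 0, every δ ≥ 0 and every x ∈ ℝ, ∫₀ᵗ ∫_ℝ ( p(s, x + δ − y) − p(s, x − y) )² dy ds ≤ δ/2. -/
open MeasureTheory Real Set

/-- The one-dimensional heat kernel `p(t,x) = (4πt)^(−1/2) · exp(−x²/(4t))`. -/
noncomputable def heatKernel (t x : ℝ) : ℝ :=
  (Real.sqrt (4 * Real.pi * t))⁻¹ * Real.exp (-(x ^ 2) / (4 * t))

lemma integral_exp_neg_mul_sub_sq (b a : ℝ) :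
    ∫ y : ℝ, Real.exp (-b * (a - y) ^ 2) = Real.sqrt (Real.pi / b) := by
  rw [integral_sub_left_eq_self (fun y : ℝ => Real.exp (-b * y ^ 2)) volume a]
  exact integral_gaussian b

lemma integrable_exp_neg_mul_sub_sq {b : ℝ} (hb : 0 < b) (a : ℝ) :
    Integrable fun y : ℝ => Real.exp (-b * (a - y) ^ 2) :=
  (integrable_exp_neg_mul_sq hb).comp_sub_left a

lemma integral_heatKernel_sub_sq {s : ℝ} (hs : 0 < s) (δ x : ℝ) :
    ∫ y : ℝ, (heatKernel s (x + δ - y) - heatKernel s (x - y)) ^ 2 =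
      (Real.sqrt (2 * Real.pi))⁻¹ * ((1 - Real.exp (-(δ ^ 2 / 8) / s)) / Real.sqrt s) := by
  have hb : 0 < 1 / (2 * s) := by positivity
  have hA : ((Real.sqrt (4 * Real.pi * s))⁻¹) ^ 2 = (4 * Real.pi * s)⁻¹ := by
    rw [inv_pow, Real.sq_sqrt (by positivity)]
  have expand : ∀ y : ℝ, (heatKernel s (x + δ - y) - heatKernel s (x - y)) ^ 2 =
      (4 * Real.pi * s)⁻¹ * (Real.exp (-(1 / (2 * s)) * (x + δ - y) ^ 2) +
        Real.exp (-(1 / (2 * s)) * (x - y) ^ 2) -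
        2 * Real.exp (-(δ ^ 2 / 8) / s) *
          Real.exp (-(1 / (2 * s)) * (x + δ / 2 - y) ^ 2)) := by
    intro y
    have e₁ : Real.exp (-(1 / (2 * s)) * (x + δ - y) ^ 2) =
        Real.exp (-((x + δ - y) ^ 2) / (4 * s)) ^ 2 := by
      rw [← Real.exp_nat_mul]; congr 1; push_cast; field_simp; ring
    have e₂ : Real.exp (-(1 / (2 * s)) * (x - y) ^ 2) =
        Real.exp (-((x - y) ^ 2) / (4 * s)) ^ 2 := by
      rw [← Real.exp_nat_mul]; congr 1; push_cast; field_simp; ring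
    have e₃ : Real.exp (-(δ ^ 2 / 8) / s) *
          Real.exp (-(1 / (2 * s)) * (x + δ / 2 - y) ^ 2) =
        Real.exp (-((x + δ - y) ^ 2) / (4 * s)) * Real.exp (-((x - y) ^ 2) / (4 * s)) := by
      rw [← Real.exp_add, ← Real.exp_add]; congr 1; field_simp; ring
    rw [mul_assoc 2, e₁, e₂, e₃, ← hA]
    simp only [heatKernel]
    ring
  simp_rw [expand]
  have i₁ := integrable_exp_neg_mul_sub_sq hb (x + δ)
  have i₂ := integrable_exp_neg_mul_sub_sq hb x
  have i₃ := (integrable_exp_neg_mul_sub_sq hb (x + δ / 2)).const_mul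
    (2 * Real.exp (-(δ ^ 2 / 8) / s))
  have i₁₂ : Integrable fun y : ℝ => Real.exp (-(1 / (2 * s)) * (x + δ - y) ^ 2) +
      Real.exp (-(1 / (2 * s)) * (x - y) ^ 2) := i₁.add i₂
  rw [integral_const_mul, integral_sub i₁₂ i₃, integral_add i₁ i₂, integral_const_mul,
    integral_exp_neg_mul_sub_sq, integral_exp_neg_mul_sub_sq, integral_exp_neg_mul_sub_sq]
  have hpi : Real.pi / (1 / (2 * s)) = 2 * Real.pi * s := by field_simp
  rw [hpi, Real.sqrt_mul (by positivity)]
  have h₁ : Real.sqrt (2 * Real.pi) ^ 2 = 2 * Real.pi := Real.sq_sqrt (by positivity)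
  have h₂ : Real.sqrt s ^ 2 = s := Real.sq_sqrt hs.le
  have h₃ : 0 < Real.sqrt (2 * Real.pi) := by positivity
  have h₄ : 0 < Real.sqrt s := by positivity
  have h₅ : (4 * Real.pi * s)⁻¹ = (2 * (Real.sqrt (2 * Real.pi) ^ 2 * Real.sqrt s ^ 2))⁻¹ := by
    rw [h₁, h₂]; ring
  rw [h₅]
  field_simp
  ring

/-- An antiderivative of `r ↦ 2 (1 - exp (-c / r²))` on `(0, ∞)`. -/
noncomputable def gaussPrimitive (c r : ℝ) : ℝ :=
  2 * r * (1 - Real.exp (-c / r ^ 2)) - 4 * c * ∫ u in (0 : ℝ)..r⁻¹, Real.exp (-c * u ^ 2)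

lemma hasDerivAt_integral_exp_neg_mul_sq (c v : ℝ) :
    HasDerivAt (fun v => ∫ u in (0 : ℝ)..v, Real.exp (-c * u ^ 2)) (Real.exp (-c * v ^ 2)) v := by
  have hc : Continuous fun u : ℝ => Real.exp (-c * u ^ 2) := by fun_prop
  exact hc.integral_hasStrictDerivAt 0 v |>.hasDerivAt

lemma hasDerivAt_gaussPrimitive (c : ℝ) {r : ℝ} (hr : 0 < r) :
    HasDerivAt (gaussPrimitive c) (2 * (1 - Real.exp (-c / r ^ 2))) r := by
  have h₁ : HasDerivAt (fun r : ℝ => -c / r ^ 2) (2 * c / r ^ 3) r := by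
    refine ((hasDerivAt_const r (-c)).div (hasDerivAt_pow 2 r) (by positivity)).congr_deriv ?_
    field_simp
    norm_num
    ring
  have h₂ := ((hasDerivAt_id r).const_mul 2).mul (h₁.exp.const_sub 1)
  have h₃ := ((hasDerivAt_integral_exp_neg_mul_sq c r⁻¹).comp r
    (hasDerivAt_inv hr.ne')).const_mul (4 * c)
  have he : -c * r⁻¹ ^ 2 = -c / r ^ 2 := by field_simp
  rw [he] at h₃
  refine (h₂.sub h₃).congr_deriv ?_
  simp only [id]
  field_simp
  ring

lemma gaussPrimitive_nonpos {c : ℝ} (hc : 0 ≤ c) {r : ℝ} (hr : 0 < r) :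
    gaussPrimitive c r ≤ 0 := by
  have hv : (0 : ℝ) ≤ r⁻¹ := by positivity
  have hint : ∫ u in (0 : ℝ)..r⁻¹, 2 * c * u * Real.exp (-c * u ^ 2) =
      1 - Real.exp (-c / r ^ 2) := by
    have hd : ∀ u ∈ Set.uIcc (0 : ℝ) r⁻¹, HasDerivAt (fun u : ℝ => -Real.exp (-c * u ^ 2))
        (2 * c * u * Real.exp (-c * u ^ 2)) u := by
      intro u _
      refine (((hasDerivAt_pow 2 u).const_mul (-c)).exp).neg.congr_deriv ?_
      norm_num
      ring
    rw [intervalIntegral.integral_eq_sub_of_hasDerivAt hd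
      ((by fun_prop : Continuous _).intervalIntegrable _ _)]
    have he : -c * r⁻¹ ^ 2 = -c / r ^ 2 := by field_simp
    rw [he]
    simp
    ring
  have hle : ∫ u in (0 : ℝ)..r⁻¹, 2 * c * u * Real.exp (-c * u ^ 2) ≤
      ∫ u in (0 : ℝ)..r⁻¹, 2 * c * r⁻¹ * Real.exp (-c * u ^ 2) := by
    refine intervalIntegral.integral_mono_on hv
      ((by fun_prop : Continuous _).intervalIntegrable _ _)
      ((by fun_prop : Continuous _).intervalIntegrable _ _) fun u hu => ?_
    have := hu.2
    gcongr
  rw [hint, intervalIntegral.integral_const_mul] at hle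
  have := mul_le_mul_of_nonneg_left hle (by positivity : 0 ≤ 2 * r)
  have e : 2 * r * (2 * c * r⁻¹ * ∫ u in (0 : ℝ)..r⁻¹, Real.exp (-c * u ^ 2)) =
      4 * c * ∫ u in (0 : ℝ)..r⁻¹, Real.exp (-c * u ^ 2) := by
    field_simp
    ring
  rw [gaussPrimitive]
  linarith

lemma tendsto_gaussPrimitive {c : ℝ} (hc : 0 < c) :
    Filter.Tendsto (gaussPrimitive c) (nhdsWithin 0 (Set.Ioi 0))
      (nhds (-(2 * Real.sqrt (Real.pi * c)))) := by
  have hid : Filter.Tendsto (fun r : ℝ => 2 * r) (nhdsWithin 0 (Set.Ioi 0)) (nhds 0) := by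
    have : Continuous fun r : ℝ => 2 * r := by fun_prop
    simpa using (this.tendsto 0).mono_left nhdsWithin_le_nhds
  have h₁ : Filter.Tendsto (fun r : ℝ => 2 * r * (1 - Real.exp (-c / r ^ 2)))
      (nhdsWithin 0 (Set.Ioi 0)) (nhds 0) := by
    refine squeeze_zero' ?_ ?_ hid
    · filter_upwards [self_mem_nhdsWithin] with r hr
      have hr : 0 < r := hr
      have : Real.exp (-c / r ^ 2) ≤ 1 := Real.exp_le_one_iff.2 (by
        rw [neg_div, neg_nonpos]; positivity)
      exact mul_nonneg (by positivity) (by linarith)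
    · filter_upwards [self_mem_nhdsWithin] with r hr
      have hr : 0 < r := hr
      have := Real.exp_pos (-c / r ^ 2)
      exact mul_le_of_le_one_right (by positivity) (by linarith)
  have h₂ := (MeasureTheory.intervalIntegral_tendsto_integral_Ioi 0
    (integrable_exp_neg_mul_sq hc).integrableOn tendsto_inv_nhdsGT_zero).const_mul (4 * c)
  rw [integral_gaussian_Ioi] at h₂
  have hsq : Real.sqrt (Real.pi * c) = c * Real.sqrt (Real.pi / c) := by
    rw [show Real.pi * c = c ^ 2 * (Real.pi / c) by field_simp,
      Real.sqrt_mul (by positivity), Real.sqrt_sq hc.le]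
  have hlim : 0 - 4 * c * (Real.sqrt (Real.pi / c) / 2) = -(2 * Real.sqrt (Real.pi * c)) := by
    rw [hsq]
    ring
  exact hlim ▸ h₁.sub h₂

lemma setIntegral_one_sub_exp_div_sqrt_le {c t : ℝ} (hc : 0 < c) (ht : 0 < t) :
    ∫ s in Set.Ioc (0 : ℝ) t, (1 - Real.exp (-c / s)) / Real.sqrt s ≤
      2 * Real.sqrt (Real.pi * c) := by
  by_cases hi : IntegrableOn (fun s => (1 - Real.exp (-c / s)) / Real.sqrt s) (Set.Ioc 0 t)
  swap
  · rw [integral_undef hi]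
    positivity
  have hd : ∀ s : ℝ, 0 < s → HasDerivAt (fun s => gaussPrimitive c (Real.sqrt s))
      ((1 - Real.exp (-c / s)) / Real.sqrt s) s := by
    intro s hs
    have h := (hasDerivAt_gaussPrimitive c (Real.sqrt_pos.2 hs)).comp s
      (Real.hasDerivAt_sqrt hs.ne')
    rw [Real.sq_sqrt hs.le] at h
    refine h.congr_deriv ?_
    field_simp
  have hsqrt : Filter.Tendsto Real.sqrt (nhdsWithin 0 (Set.Ioi 0))
      (nhdsWithin 0 (Set.Ioi 0)) := by
    refine tendsto_nhdsWithin_iff.2 ⟨?_, ?_⟩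
    · simpa using (Real.continuous_sqrt.tendsto 0).mono_left nhdsWithin_le_nhds
    · filter_upwards [self_mem_nhdsWithin] with s hs using Real.sqrt_pos.2 hs
  rw [← intervalIntegral.integral_of_le ht.le,
    intervalIntegral.integral_eq_sub_of_hasDerivAt_of_tendsto ht (fun s hs => hd s hs.1)
      ((intervalIntegrable_iff_integrableOn_Ioc_of_le ht.le).2 hi)
      ((tendsto_gaussPrimitive hc).comp hsqrt)
      ((hd t ht).continuousAt.tendsto.mono_left nhdsWithin_le_nhds)]
  linarith [gaussPrimitive_nonpos hc.le (Real.sqrt_pos.2 ht)]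

/-- For every `t > 0`, `δ ≥ 0` and `x ∈ ℝ`,
`∫₀ᵗ ∫_ℝ (p(s, x + δ − y) − p(s, x − y))² dy ds ≤ δ/2`. -/
theorem heatKernel_space_increment_L2 (t δ x : ℝ) (ht : 0 < t) (hδ : 0 ≤ δ) :
    ∫ s in Set.Ioc (0 : ℝ) t, ∫ y : ℝ,
        (heatKernel s (x + δ - y) - heatKernel s (x - y)) ^ 2 ≤ δ / 2 := by
  rcases hδ.eq_or_lt with rfl | hδ
  · simp
  rw [setIntegral_congr_fun measurableSet_Ioc
    fun s hs => integral_heatKernel_sub_sq hs.1 δ x, integral_const_mul]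
  have hsq : Real.sqrt (Real.pi * (δ ^ 2 / 8)) = Real.sqrt (2 * Real.pi) * (δ / 4) := by
    rw [show Real.pi * (δ ^ 2 / 8) = 2 * Real.pi * (δ / 4) ^ 2 by ring,
      Real.sqrt_mul (by positivity), Real.sqrt_sq (by positivity)]
  have hpos : 0 < Real.sqrt (2 * Real.pi) := by positivity
  calc _ ≤ (Real.sqrt (2 * Real.pi))⁻¹ * (2 * Real.sqrt (Real.pi * (δ ^ 2 / 8))) := by
        gcongr
        exact setIntegral_one_sub_exp_div_sqrt_le (by positivity) ht
    _ = δ / 2 := by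
        rw [hsq]
        field_simp
        ring
end

section
/- For every δ ≥ 0, ∫₀^∞ ∫_ℝ ( p(s + δ, y) − p(s, y) )² dy ds = (√2 − 1) · √(δ/(2π)). -/
open MeasureTheory Real Set

lemma heatKernel_mul_eq (a b : ℝ) (y : ℝ) :
    heatKernel a y * heatKernel b y =
      ((√(4 * π * a))⁻¹ * (√(4 * π * b))⁻¹) * exp (-(1 / (4 * a) + 1 / (4 * b)) * y ^ 2) := by
  have h : -(1 / (4 * a) + 1 / (4 * b)) * y ^ 2 = -(y ^ 2) / (4 * a) + -(y ^ 2) / (4 * b) := by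
    ring
  rw [h, exp_add, heatKernel, heatKernel]
  ring

lemma integrable_heatKernel_mul {a b : ℝ} (ha : 0 < a) (hb : 0 < b) :
    Integrable (fun y : ℝ => heatKernel a y * heatKernel b y) := by
  simp only [heatKernel_mul_eq]
  exact (integrable_exp_neg_mul_sq (by positivity)).const_mul _

lemma integral_heatKernel_mul {a b : ℝ} (ha : 0 < a) (hb : 0 < b) :
    ∫ y : ℝ, heatKernel a y * heatKernel b y = (√(4 * π * (a + b)))⁻¹ := by
  simp only [heatKernel_mul_eq]
  rw [integral_const_mul, integral_gaussian, ← sqrt_inv, ← sqrt_inv, ← sqrt_inv,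
    ← sqrt_mul (by positivity), ← sqrt_mul (by positivity)]
  congr 1
  field_simp
  ring

lemma integral_sq_heatKernel_sub {a b : ℝ} (ha : 0 < a) (hb : 0 < b) :
    ∫ y : ℝ, (heatKernel a y - heatKernel b y) ^ 2 =
      (√(4 * π * (a + a)))⁻¹ - 2 * (√(4 * π * (a + b)))⁻¹ + (√(4 * π * (b + b)))⁻¹ := by
  have h (y : ℝ) : (heatKernel a y - heatKernel b y) ^ 2 =
      heatKernel a y * heatKernel a y - 2 * (heatKernel a y * heatKernel b y)
        + heatKernel b y * heatKernel b y := by ring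
  have haa := integrable_heatKernel_mul ha ha
  have hab := (integrable_heatKernel_mul ha hb).const_mul 2
  have hsub : Integrable
      (fun y : ℝ => heatKernel a y * heatKernel a y - 2 * (heatKernel a y * heatKernel b y)) :=
    haa.sub hab
  simp only [h]
  rw [integral_add hsub (integrable_heatKernel_mul hb hb), integral_sub haa hab,
    integral_const_mul, integral_heatKernel_mul ha ha, integral_heatKernel_mul ha hb,
    integral_heatKernel_mul hb hb]

lemma tendsto_sqrt_add_sub_sqrt_atTop {c : ℝ} (hc : 0 ≤ c) :
    Filter.Tendsto (fun x : ℝ => √(x + c) - √x) Filter.atTop (nhds 0) := by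
  refine tendsto_of_tendsto_of_tendsto_of_le_of_le' tendsto_const_nhds
    (Filter.Tendsto.const_div_atTop Real.tendsto_sqrt_atTop c) ?_ ?_
  · exact Filter.Eventually.of_forall fun x => sub_nonneg.2 (sqrt_le_sqrt (by linarith))
  · filter_upwards [Filter.eventually_gt_atTop 0] with x hx
    have h0 : 0 < √x := sqrt_pos.2 hx
    have h1 : √x ≤ √(x + c) := sqrt_le_sqrt (by linarith)
    rw [le_div_iff₀ h0]
    nlinarith [sq_sqrt hx.le, sq_sqrt (add_nonneg hx.le hc)]

lemma hasDerivAt_sqrt_two_mul_add {s c : ℝ} (h : 0 < 2 * s + c) :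
    HasDerivAt (fun s : ℝ => √(2 * s + c)) (√(2 * s + c))⁻¹ s := by
  have h1 : HasDerivAt (fun s : ℝ => 2 * s + c) 2 s := by
    simpa using ((hasDerivAt_id s).const_mul 2).add_const c
  convert h1.sqrt h.ne' using 1
  field_simp

/-- For every `δ ≥ 0`,
`∫₀^∞ ∫_ℝ (p(s + δ, y) − p(s, y))² dy ds = (√2 − 1) · √(δ/(2π))`. -/
theorem heatKernel_time_increment_L2 (δ : ℝ) (hδ : 0 ≤ δ) :
    ∫ s in Set.Ioi (0 : ℝ), ∫ y : ℝ,
        (heatKernel (s + δ) y - heatKernel s y) ^ 2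
      = (Real.sqrt 2 - 1) * Real.sqrt (δ / (2 * Real.pi)) := by
  let F : ℝ → ℝ := fun s =>
    (√(4 * π))⁻¹ * (√(2 * s + 2 * δ) - 2 * √(2 * s + δ) + √(2 * s + 0))
  have hderiv : ∀ s ∈ Ioi (0 : ℝ), HasDerivAt F
      (∫ y : ℝ, (heatKernel (s + δ) y - heatKernel s y) ^ 2) s := by
    intro s hs
    have hs : 0 < s := hs
    rw [integral_sq_heatKernel_sub (by positivity) hs]
    have hF := ((((hasDerivAt_sqrt_two_mul_add (s := s) (c := 2 * δ) (by positivity)).sub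
      ((hasDerivAt_sqrt_two_mul_add (s := s) (c := δ) (by positivity)).const_mul 2)).add
      (hasDerivAt_sqrt_two_mul_add (s := s) (c := 0) (by positivity))).const_mul
        (√(4 * π))⁻¹)
    refine HasDerivAt.congr_deriv (f := F) hF ?_
    have h4 : 0 ≤ 4 * π := by positivity
    rw [sqrt_mul h4, sqrt_mul h4, sqrt_mul h4,
      show s + δ + (s + δ) = 2 * s + 2 * δ by ring, show s + δ + s = 2 * s + δ by ring,
      show s + s = 2 * s + 0 by ring]
    simp only [mul_inv]
    ring
  have hcont : ContinuousWithinAt F (Ici 0) 0 := by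
    have : Continuous F := by fun_prop
    exact this.continuousWithinAt
  have hlim : Filter.Tendsto F Filter.atTop (nhds 0) := by
    have h2 : Filter.Tendsto (fun s : ℝ => 2 * s) Filter.atTop Filter.atTop :=
      Filter.tendsto_id.const_mul_atTop two_pos
    have hA := (tendsto_sqrt_add_sub_sqrt_atTop hδ).comp h2
    have hB := (tendsto_sqrt_add_sub_sqrt_atTop hδ).comp
      (Filter.tendsto_atTop_add_const_right _ δ h2)
    have := (hB.sub hA).const_mul (√(4 * π))⁻¹
    simp only [sub_zero, mul_zero] at this
    refine this.congr fun s => ?_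
    simp only [F, Function.comp, add_zero, show 2 * s + δ + δ = 2 * s + 2 * δ by ring]
    ring
  rw [integral_Ioi_of_hasDerivAt_of_nonneg hcont hderiv
    (fun s _ => integral_nonneg fun y => sq_nonneg _) hlim]
  have h4 : √(4 * π) = 2 * √π := by
    rw [sqrt_mul (by norm_num), show (4 : ℝ) = 2 ^ 2 by norm_num, sqrt_sq (by norm_num)]
  simp only [F, mul_zero, zero_add, sqrt_zero, add_zero]
  rw [h4, sqrt_div hδ, sqrt_mul (by norm_num), sqrt_mul (by norm_num)]
  have hπ : 0 < √π := sqrt_pos.2 pi_pos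
  have h2 : √2 * √2 = (2 : ℝ) := mul_self_sqrt (by norm_num)
  field_simp
  linear_combination (-√δ) * h2
end

section
/- For every T > 0, every infinitely differentiable compactly supported function φ : ℝ² → ℝ, every s ∈ [0,T) and every y ∈ ℝ, ∫ₛᵀ ∫_ℝ p(t − s, x − y) · ( ∂φ/∂t (t,x) + ∂²φ/∂x² (t,x) ) dx dt = ∫_ℝ p(T − s, x − y) φ(T, x) dx − φ(s, y). -/
open MeasureTheory Real Set

lemma continuous_heatKernel (t : ℝ) : Continuous (heatKernel t) := by
  unfold heatKernel
  fun_prop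

lemma heatKernel_one_eq (z : ℝ) :
    heatKernel 1 z = (√(4 * π))⁻¹ * exp (-(1 / 4) * z ^ 2) := by
  unfold heatKernel
  congr 2
  · ring_nf
  · ring

lemma integrable_heatKernel_one : Integrable (heatKernel 1) := by
  simp only [funext heatKernel_one_eq]
  exact (integrable_exp_neg_mul_sq (by norm_num)).const_mul _

lemma integrable_mul_heatKernel_one : Integrable fun z => z * heatKernel 1 z := by
  refine ((integrable_mul_exp_neg_mul_sq (b := 1 / 4) (by norm_num)).const_mul
    (√(4 * π))⁻¹).congr (.of_forall fun z => ?_)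
  simp only [heatKernel_one_eq]
  ring

lemma integral_heatKernel_one : ∫ z, heatKernel 1 z = 1 := by
  simp only [heatKernel_one_eq, integral_const_mul, integral_gaussian]
  rw [show π / (1 / 4) = 4 * π by ring]
  exact inv_mul_cancel₀ (by positivity)

lemma hasDerivAt_heatKernel_one (z : ℝ) :
    HasDerivAt (heatKernel 1) (-(z / 2) * heatKernel 1 z) z := by
  have h := ((((hasDerivAt_id z).pow 2).const_mul (-(1 / 4) : ℝ)).exp).const_mul (√(4 * π))⁻¹
  rw [funext heatKernel_one_eq]
  refine h.congr_deriv ?_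
  simp
  ring

lemma heatKernel_sqrt_mul {r : ℝ} (hr : 0 < r) (z : ℝ) :
    heatKernel r (√r * z) = (√r)⁻¹ * heatKernel 1 z := by
  unfold heatKernel
  rw [Real.sqrt_mul (by positivity) r, mul_pow, Real.sq_sqrt hr.le, mul_one, mul_inv]
  rw [show -(r * z ^ 2) / (4 * r) = -z ^ 2 / (4 * 1) by field_simp]
  ring

/-- Parabolic rescaling of the convolution with the heat kernel. -/
lemma integral_heatKernel_mul_s6 {r : ℝ} (hr : 0 < r) (y : ℝ) (f : ℝ → ℝ) :
    ∫ x, heatKernel r (x - y) * f x = ∫ z, heatKernel 1 z * f (y + √r * z) := by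
  have hr' : 0 < √r := Real.sqrt_pos.2 hr
  rw [← integral_add_right_eq_self (fun x => heatKernel r (x - y) * f x) y]
  have h := Measure.integral_comp_mul_left (fun x => heatKernel r x * f (y + x)) √r
  simp only [heatKernel_sqrt_mul hr, mul_assoc, integral_const_mul, smul_eq_mul,
    abs_of_pos (inv_pos.2 hr')] at h
  simp only [add_comm _ y, add_sub_cancel_left]
  exact (mul_left_cancel₀ (inv_pos.2 hr').ne' h).symm

section Rescaled

variable {ψ : ℝ × ℝ → ℝ} (s y : ℝ)

lemma continuous_integral_heatKernel_one_mul (hψ : Continuous ψ) (hsupp : HasCompactSupport ψ) :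
    Continuous fun t => ∫ z, heatKernel 1 z * ψ (t, y + √(t - s) * z) := by
  obtain ⟨C, hC⟩ := hsupp.exists_bound_of_continuous hψ
  refine continuous_of_dominated (bound := fun z => ‖heatKernel 1 z‖ * C) (fun t => ?_)
    (fun t => .of_forall fun z => ?_) (integrable_heatKernel_one.norm.mul_const C)
    (.of_forall fun z => by fun_prop)
  · have := continuous_heatKernel 1
    exact Continuous.aestronglyMeasurable (by fun_prop)
  · rw [norm_mul]
    gcongr
    exact hC _

lemma integral_mul_heatKernel_one_mul {f f' : ℝ → ℝ} {C C' : ℝ}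
    (hf : ∀ z, HasDerivAt f (f' z) z) (hf' : Continuous f')
    (hC : ∀ z, ‖f z‖ ≤ C) (hC' : ∀ z, ‖f' z‖ ≤ C') :
    ∫ z, z * heatKernel 1 z * f z = 2 * ∫ z, heatKernel 1 z * f' z := by
  have hfc : Continuous f := continuous_iff_continuousAt.2 fun z => (hf z).continuousAt
  have hi := integrable_mul_heatKernel_one.mul_bdd hfc.aestronglyMeasurable (.of_forall hC)
  rw [integral_mul_deriv_eq_deriv_mul_of_integrable (fun z _ => hasDerivAt_heatKernel_one z)
    (fun z _ => hf z)
    (integrable_heatKernel_one.mul_bdd hf'.aestronglyMeasurable (.of_forall hC'))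
    ((hi.const_mul (-(1 / 2))).congr (.of_forall fun z => by simp; ring))
    (integrable_heatKernel_one.mul_bdd hfc.aestronglyMeasurable (.of_forall hC)),
    ← integral_neg, ← integral_const_mul]
  congr 1 with z
  ring

lemma hasDerivAt_integral_heatKernel_one_mul {ψ₁ ψ₂ ψ₂₂ : ℝ × ℝ → ℝ}
    (hψ : Continuous ψ) (hsupp : HasCompactSupport ψ)
    (hψ₁ : Continuous ψ₁) (hsupp₁ : HasCompactSupport ψ₁)
    (hψ₂ : Continuous ψ₂) (hsupp₂ : HasCompactSupport ψ₂)
    (hψ₂₂ : Continuous ψ₂₂) (hsupp₂₂ : HasCompactSupport ψ₂₂)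
    (hd : ∀ (c : ℝ → ℝ) (c' t : ℝ), HasDerivAt c c' t →
      HasDerivAt (fun τ => ψ (τ, c τ)) (ψ₁ (t, c t) + c' * ψ₂ (t, c t)) t)
    (hd₂ : ∀ t x, HasDerivAt (fun ξ => ψ₂ (t, ξ)) (ψ₂₂ (t, x)) x) {t : ℝ} (ht : s < t) :
    HasDerivAt (fun t => ∫ z, heatKernel 1 z * ψ (t, y + √(t - s) * z))
      (∫ z, heatKernel 1 z * (ψ₁ (t, y + √(t - s) * z) + ψ₂₂ (t, y + √(t - s) * z))) t := by
  have hG := continuous_heatKernel 1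
  obtain ⟨C, hC⟩ := hsupp.exists_bound_of_continuous hψ
  obtain ⟨C₁, hC₁⟩ := hsupp₁.exists_bound_of_continuous hψ₁
  obtain ⟨C₂, hC₂⟩ := hsupp₂.exists_bound_of_continuous hψ₂
  obtain ⟨C₂₂, hC₂₂⟩ := hsupp₂₂.exists_bound_of_continuous hψ₂₂
  set a := (s + t) / 2 with ha
  have hsa : 0 < a - s := by linarith
  have hts : 0 < √(t - s) := Real.sqrt_pos.2 (sub_pos.2 ht)
  have key := (hasDerivAt_integral_of_dominated_loc_of_deriv_le (μ := volume)
    (F := fun t z => heatKernel 1 z * ψ (t, y + √(t - s) * z))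
    (F' := fun t z => heatKernel 1 z *
      (ψ₁ (t, y + √(t - s) * z) + 1 / (2 * √(t - s)) * z * ψ₂ (t, y + √(t - s) * z)))
    (bound := fun z => ‖heatKernel 1 z‖ * C₁ +
      1 / (2 * √(a - s)) * (‖z * heatKernel 1 z‖ * C₂))
    (Ioi_mem_nhds (show a < t by linarith))
    (.of_forall fun t => Continuous.aestronglyMeasurable (by fun_prop))
    (integrable_heatKernel_one.mul_bdd
      (Continuous.aestronglyMeasurable (by fun_prop)) (.of_forall fun z => hC _))
    (Continuous.aestronglyMeasurable (by fun_prop))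
    (.of_forall fun z τ hτ => ?_)
    ((integrable_heatKernel_one.norm.mul_const C₁).add
      ((integrable_mul_heatKernel_one.norm.mul_const C₂).const_mul _))
    (.of_forall fun z τ hτ => ?_)).2
  · refine key.congr_deriv ?_
    have i₁ : Integrable fun z => heatKernel 1 z * ψ₁ (t, y + √(t - s) * z) :=
      integrable_heatKernel_one.mul_bdd
        (Continuous.aestronglyMeasurable (by fun_prop)) (.of_forall fun z => hC₁ _)
    have i₂ : Integrable fun z => z * heatKernel 1 z * ψ₂ (t, y + √(t - s) * z) :=
      integrable_mul_heatKernel_one.mul_bdd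
        (Continuous.aestronglyMeasurable (by fun_prop)) (.of_forall fun z => hC₂ _)
    have i₂₂ : Integrable fun z => heatKernel 1 z * ψ₂₂ (t, y + √(t - s) * z) :=
      integrable_heatKernel_one.mul_bdd
        (Continuous.aestronglyMeasurable (by fun_prop)) (.of_forall fun z => hC₂₂ _)
    have parts := integral_mul_heatKernel_one_mul
      (f := fun z => ψ₂ (t, y + √(t - s) * z))
      (f' := fun z => √(t - s) * ψ₂₂ (t, y + √(t - s) * z)) (C' := √(t - s) * C₂₂)
      (fun z => by
        have h := (hd₂ t (y + √(t - s) * z)).comp z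
          (((hasDerivAt_id z).const_mul √(t - s)).const_add y)
        exact h.congr_deriv (by ring))
      (by fun_prop) (fun z => hC₂ _)
      (fun z => by
        rw [norm_mul, Real.norm_of_nonneg hts.le]
        gcongr
        exact hC₂₂ _)
    calc _ = ∫ z, (heatKernel 1 z * ψ₁ (t, y + √(t - s) * z) +
          1 / (2 * √(t - s)) * (z * heatKernel 1 z * ψ₂ (t, y + √(t - s) * z))) := by
          congr 1 with z
          ring
      _ = ∫ z, (heatKernel 1 z * ψ₁ (t, y + √(t - s) * z) +
          heatKernel 1 z * ψ₂₂ (t, y + √(t - s) * z)) := by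
          simp only [mul_left_comm _ √(t - s), integral_const_mul] at parts
          rw [integral_add i₁ (i₂.const_mul _), integral_add i₁ i₂₂, integral_const_mul, parts]
          field_simp
      _ = _ := by simp only [mul_add]
  · have hτ' : √(a - s) ≤ √(τ - s) := Real.sqrt_le_sqrt (by linarith [mem_Ioi.1 hτ])
    have ha' : 0 < √(a - s) := Real.sqrt_pos.2 hsa
    calc _ = ‖heatKernel 1 z * ψ₁ (τ, y + √(τ - s) * z) +
          1 / (2 * √(τ - s)) * (z * heatKernel 1 z * ψ₂ (τ, y + √(τ - s) * z))‖ := by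
          congr 1
          ring
      _ ≤ _ := by
          refine (norm_add_le _ _).trans ?_
          rw [norm_mul, norm_mul (1 / (2 * √(τ - s))), norm_mul (z * _),
            Real.norm_of_nonneg (show 0 ≤ 1 / (2 * √(τ - s)) by positivity)]
          gcongr
          · exact hC₁ _
          · exact hC₂ _
  · have hpos : τ - s ≠ 0 := by linarith [mem_Ioi.1 hτ]
    have hc := ((((hasDerivAt_id τ).sub_const s).sqrt hpos).mul_const z).const_add y
    exact (hd _ _ τ hc).const_mul _

end Rescaled

/-- For every `T > 0`, every smooth compactly supported `φ : ℝ² → ℝ`, every `s ∈ [0,T)`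
and `y ∈ ℝ`,
`∫ₛᵀ ∫_ℝ p(t − s, x − y)(∂φ/∂t (t,x) + ∂²φ/∂x² (t,x)) dx dt
  = ∫_ℝ p(T − s, x − y) φ(T,x) dx − φ(s,y)`. -/
theorem heatKernel_duality (T : ℝ) (hT : 0 < T) (φ : ℝ × ℝ → ℝ)
    (hφ : ContDiff ℝ (⊤ : ℕ∞) φ) (hsupp : HasCompactSupport φ)
    (s : ℝ) (hs : s ∈ Set.Ico (0 : ℝ) T) (y : ℝ) :
    ∫ t in Set.Ioc s T, ∫ x : ℝ,
        heatKernel (t - s) (x - y) *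
          (deriv (fun τ => φ (τ, x)) t + deriv (fun ξ => deriv (fun ξ' => φ (t, ξ')) ξ) x)
      = (∫ x : ℝ, heatKernel (T - s) (x - y) * φ (T, x)) - φ (s, y) := by
  have hsT : s < T := hs.2
  have hd (p : ℝ × ℝ) : HasFDerivAt φ (fderiv ℝ φ p) p :=
    (hφ.differentiable (by simp) p).hasFDerivAt
  have hφ' (v : ℝ × ℝ) : ContDiff ℝ (⊤ : ℕ∞) fun p => fderiv ℝ φ p v :=
    (hφ.fderiv_right (by simp)).clm_apply contDiff_const
  set φ₁ : ℝ × ℝ → ℝ := fun p => fderiv ℝ φ p (1, 0)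
  set φ₂ : ℝ × ℝ → ℝ := fun p => fderiv ℝ φ p (0, 1)
  set φ₂₂ : ℝ × ℝ → ℝ := fun p => fderiv ℝ φ₂ p (0, 1)
  have s₁ : HasCompactSupport φ₁ := hsupp.fderiv_apply (𝕜 := ℝ) _
  have s₂ : HasCompactSupport φ₂ := hsupp.fderiv_apply (𝕜 := ℝ) _
  have s₂₂ : HasCompactSupport φ₂₂ := s₂.fderiv_apply (𝕜 := ℝ) _
  have c₁ : Continuous φ₁ := (hφ' _).continuous
  have c₂ : ContDiff ℝ (⊤ : ℕ∞) φ₂ := hφ' _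
  have c₂₂ : Continuous φ₂₂ :=
    ((c₂.fderiv_right (m := (⊤ : ℕ∞)) (by simp)).clm_apply contDiff_const).continuous
  have d (c : ℝ → ℝ) (c' t : ℝ) (hc : HasDerivAt c c' t) :
      HasDerivAt (fun τ => φ (τ, c τ)) (φ₁ (t, c t) + c' * φ₂ (t, c t)) t := by
    refine ((hd (t, c t)).comp_hasDerivAt t ((hasDerivAt_id t).prodMk hc)).congr_deriv ?_
    rw [show ((1 : ℝ), c') = (1, 0) + c' • (0, 1) by simp, map_add, map_smul, smul_eq_mul]
  have d₁ (t x : ℝ) : deriv (fun τ => φ (τ, x)) t = φ₁ (t, x) := by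
    simpa using (d _ _ t (hasDerivAt_const t x)).deriv
  have d₂ (t x : ℝ) : deriv (fun ξ => φ (t, ξ)) x = φ₂ (t, x) :=
    ((hd (t, x)).comp_hasDerivAt x ((hasDerivAt_const x t).prodMk (hasDerivAt_id x))).deriv
  have d₂₂ (t x : ℝ) : HasDerivAt (fun ξ => φ₂ (t, ξ)) (φ₂₂ (t, x)) x :=
    ((c₂.differentiable (by simp) (t, x)).hasFDerivAt).comp_hasDerivAt x
      ((hasDerivAt_const x t).prodMk (hasDerivAt_id x))
  simp only [d₁, d₂, fun t x => (d₂₂ t x).deriv]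
  rw [setIntegral_congr_fun measurableSet_Ioc fun t ht =>
      integral_heatKernel_mul_s6 (sub_pos.2 ht.1) y fun x => φ₁ (t, x) + φ₂₂ (t, x),
    integral_heatKernel_mul_s6 (sub_pos.2 hsT), ← intervalIntegral.integral_of_le hsT.le,
    intervalIntegral.integral_eq_sub_of_hasDerivAt_of_le hsT.le
      (continuous_integral_heatKernel_one_mul s y hφ.continuous hsupp).continuousOn
      (fun t ht => hasDerivAt_integral_heatKernel_one_mul s y hφ.continuous hsupp c₁ s₁
        c₂.continuous s₂ c₂₂ s₂₂ d d₂₂ ht.1)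
      (continuous_integral_heatKernel_one_mul s y (c₁.add c₂₂)
        (s₁.add s₂₂)).continuousOn.intervalIntegrable]
  simp [integral_mul_const, integral_heatKernel_one]
end
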